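/- Fix M ∈ ℝ and ε > 0, and let Ψ(A) = A ∩ (−∞, M]. If A_1, …, A_d, B_1, …, B_d ⊆ ℝ are closed sets such that (Ψ ∘ C_ε)(A_i) ∼ (Ψ ∘ C_ε)(B_i) for every i ∈ [d], then (Ψ ∘ C_ε)(A_1 ∪ ⋯ ∪ A_d) ∼ (Ψ ∘ C_ε)(B_1 ∪ ⋯ ∪ B_d). -/

import Mathlib

/-- The ε-closure of a set `S ⊆ ℝ`:
`C_ε(S) = {y : ∃ x, z ∈ S, x ≤ y ≤ z ≤ x + ε}`. -/
def eClosure (ε : ℝ) (S : Set ℝ) : Set ℝ :=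
  {y | ∃ x ∈ S, ∃ z ∈ S, x ≤ y ∧ y ≤ z ∧ z ≤ x + ε}

/-- The relation `S₁ ∼ S₂` (relative to `M` and `ε`): the two sets agree on
`(-∞, M - ε]`, and their parts in `[M - ε, ∞)` are either both empty or both
nonempty with equal infima. -/
def simRel (M ε : ℝ) (S₁ S₂ : Set ℝ) : Prop :=
  S₁ ∩ Set.Iic (M - ε) = S₂ ∩ Set.Iic (M - ε) ∧
  ((S₁ ∩ Set.Ici (M - ε) = ∅ ∧ S₂ ∩ Set.Ici (M - ε) = ∅) ∨
   ((S₁ ∩ Set.Ici (M - ε)).Nonempty ∧ (S₂ ∩ Set.Ici (M - ε)).Nonempty ∧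
     sInf (S₁ ∩ Set.Ici (M - ε)) = sInf (S₂ ∩ Set.Ici (M - ε))))

theorem eC_sub {ε : ℝ} (hε : 0 < ε) {S : Set ℝ} : S ⊆ eClosure ε S :=
  fun x hx => ⟨x, hx, x, hx, le_rfl, le_rfl, by linarith⟩

theorem eC_mono {ε : ℝ} {S T : Set ℝ} (h : S ⊆ T) : eClosure ε S ⊆ eClosure ε T := by
  rintro y ⟨x, hx, z, hz, h1⟩
  exact ⟨x, h hx, z, h hz, h1⟩

theorem eC_left {ε : ℝ} {S : Set ℝ} {y t : ℝ} (hy : y ∉ eClosure ε S) (ht : t ∈ eClosure ε S)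
    (hty : t ≤ y) : ∃ s ∈ S, t ≤ s ∧ s ≤ y := by
  obtain ⟨x, hx, z, hz, h1, h2, h3⟩ := ht
  by_contra hc
  push Not at hc
  exact hy ⟨x, hx, z, hz, by linarith, (hc z hz h2).le, h3⟩

theorem eC_right {ε : ℝ} {S : Set ℝ} {y t : ℝ} (hy : y ∉ eClosure ε S) (ht : t ∈ eClosure ε S)
    (hty : y ≤ t) : ∃ s ∈ S, y ≤ s ∧ s ≤ t := by
  obtain ⟨x, hx, z, hz, h1, h2, h3⟩ := ht
  by_contra hc
  push Not at hc
  refine hy ⟨x, hx, z, hz, ?_, by linarith, h3⟩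
  by_contra h4
  exact absurd (hc x hx (by linarith)) (by linarith)

theorem eC_idem {ε : ℝ} {S : Set ℝ} : eClosure ε (eClosure ε S) ⊆ eClosure ε S := by
  rintro y ⟨x, hx, z, hz, h1, h2, h3⟩
  by_contra hy
  obtain ⟨s, hs, a, b⟩ := eC_left hy hx h1
  obtain ⟨t, ht, c, e⟩ := eC_right hy hz h2
  exact hy ⟨s, hs, t, ht, b, c, by linarith⟩

theorem eC_closed {ε : ℝ} (hε : 0 < ε) {S : Set ℝ} (hS : IsClosed S) :
    IsClosed (eClosure ε S) := by
  rw [← isOpen_compl_iff, Metric.isOpen_iff]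
  intro y hy
  have hyS : y ∈ Sᶜ := fun h => hy (eC_sub hε h)
  obtain ⟨r, hr, hb⟩ := Metric.isOpen_iff.1 hS.isOpen_compl y hyS
  refine ⟨r, hr, fun t ht htC => ?_⟩
  rw [Metric.mem_ball, Real.dist_eq, abs_lt] at ht
  rcases le_total t y with h | h
  · obtain ⟨s, hs, a, b⟩ := eC_left hy htC h
    refine hb (a := s) ?_ hs
    rw [Metric.mem_ball, Real.dist_eq, abs_lt]
    constructor <;> linarith
  · obtain ⟨s, hs, a, b⟩ := eC_right hy htC h
    refine hb (a := s) ?_ hs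
    rw [Metric.mem_ball, Real.dist_eq, abs_lt]
    constructor <;> linarith

theorem simRel_symm {M ε : ℝ} {S T : Set ℝ} (h : simRel M ε S T) : simRel M ε T S := by
  obtain ⟨h1, h2⟩ := h
  refine ⟨h1.symm, ?_⟩
  rcases h2 with ⟨a, b⟩ | ⟨a, b, c⟩
  · exact Or.inl ⟨b, a⟩
  · exact Or.inr ⟨b, a, c.symm⟩

theorem half_step {M ε : ℝ} (hε : 0 < ε) {d : ℕ} {A B : Fin d → Set ℝ}
    (hB : ∀ i, IsClosed (B i))
    (h : ∀ i, simRel M ε (eClosure ε (A i) ∩ Set.Iic M)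
      (eClosure ε (B i) ∩ Set.Iic M)) :
    (∀ y ∈ eClosure ε (⋃ i, A i), y ≤ M - ε → y ∈ eClosure ε (⋃ i, B i)) ∧
    (∀ y ∈ eClosure ε (⋃ i, A i), M - ε ≤ y → y ≤ M →
      ∃ m ∈ eClosure ε (⋃ i, B i), M - ε ≤ m ∧ m ≤ y) := by
  have ha : ∀ i, ∀ x ∈ A i, x ≤ M - ε → x ∈ eClosure ε (⋃ i, B i) := by
    intro i x hx hxM
    have : x ∈ (eClosure ε (A i) ∩ Set.Iic M) ∩ Set.Iic (M - ε) :=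
      ⟨⟨eC_sub hε hx, by simp only [Set.mem_Iic]; linarith⟩, hxM⟩
    rw [(h i).1] at this
    exact eC_mono (Set.subset_iUnion B i) this.1.1
  have hb : ∀ i, ∀ z ∈ A i, M - ε ≤ z → z ≤ M →
      ∃ m ∈ eClosure ε (⋃ i, B i), M - ε ≤ m ∧ m ≤ z := by
    intro i z hz h1 h2
    have hzm : z ∈ (eClosure ε (A i) ∩ Set.Iic M) ∩ Set.Ici (M - ε) :=
      ⟨⟨eC_sub hε hz, h2⟩, h1⟩
    rcases (h i).2 with ⟨a, b⟩ | ⟨a, b, c⟩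
    · rw [a] at hzm
      exact hzm.elim
    · have hcl : IsClosed ((eClosure ε (B i) ∩ Set.Iic M) ∩ Set.Ici (M - ε)) :=
        ((eC_closed hε (hB i)).inter isClosed_Iic).inter isClosed_Ici
      have hm := hcl.csInf_mem b ⟨M - ε, fun t ht => ht.2⟩
      refine ⟨_, eC_mono (Set.subset_iUnion B i) hm.1.1, hm.2, ?_⟩
      rw [← c]
      exact csInf_le ⟨M - ε, fun t ht => ht.2⟩ hzm
  constructor
  · rintro y ⟨x, hx, z, hz, h1, h2, h3⟩ hy
    obtain ⟨i, hx⟩ := Set.mem_iUnion.1 hx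
    obtain ⟨j, hz⟩ := Set.mem_iUnion.1 hz
    have hxB := ha i x hx (by linarith)
    rcases le_total z (M - ε) with hc | hc
    · exact eC_idem ⟨x, hxB, z, ha j z hz hc, h1, h2, h3⟩
    · obtain ⟨m, hm, h4, h5⟩ := hb j z hz hc (by linarith)
      exact eC_idem ⟨x, hxB, m, hm, h1, by linarith, by linarith⟩
  · rintro y ⟨x, hx, z, hz, h1, h2, h3⟩ hy hyM
    obtain ⟨i, hx⟩ := Set.mem_iUnion.1 hx
    obtain ⟨j, hz⟩ := Set.mem_iUnion.1 hz
    rcases le_total (M - ε) x with hc | hc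
    · obtain ⟨m, hm, h4, h5⟩ := hb i x hx hc (by linarith)
      exact ⟨m, hm, h4, by linarith⟩
    · obtain ⟨m, hm, h4, h5⟩ := hb j z hz (by linarith) (by linarith)
      rcases le_total m y with h6 | h6
      · exact ⟨m, hm, h4, h6⟩
      · exact ⟨y, eC_idem ⟨x, ha i x hx hc, m, hm, h1, h6, by linarith⟩, hy, le_rfl⟩

/-- If closed sets satisfy `(Ψ ∘ C_ε)(A i) ∼ (Ψ ∘ C_ε)(B i)` for all `i`, then
`(Ψ ∘ C_ε)(A 1 ∪ ⋯ ∪ A d) ∼ (Ψ ∘ C_ε)(B 1 ∪ ⋯ ∪ B d)`, where `Ψ(A) = A ∩ (-∞, M]`. -/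
theorem stmt17 (M ε : ℝ) (hε : 0 < ε) (d : ℕ) (A B : Fin d → Set ℝ)
    (hA : ∀ i, IsClosed (A i)) (hB : ∀ i, IsClosed (B i))
    (h : ∀ i, simRel M ε (eClosure ε (A i) ∩ Set.Iic M)
      (eClosure ε (B i) ∩ Set.Iic M)) :
    simRel M ε (eClosure ε (⋃ i, A i) ∩ Set.Iic M)
      (eClosure ε (⋃ i, B i) ∩ Set.Iic M) := by
  obtain ⟨p1, p2⟩ := half_step hε hB h
  obtain ⟨q1, q2⟩ := half_step hε hA (fun i => simRel_symm (h i))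
  have P : ∀ y ∈ (eClosure ε (⋃ i, A i) ∩ Set.Iic M) ∩ Set.Ici (M - ε),
      ∃ m ∈ (eClosure ε (⋃ i, B i) ∩ Set.Iic M) ∩ Set.Ici (M - ε), m ≤ y := by
    rintro y ⟨⟨a, b⟩, c⟩
    obtain ⟨m, hm, h1, h2⟩ := p2 y a c b
    exact ⟨m, ⟨⟨hm, h2.trans b⟩, h1⟩, h2⟩
  have Q : ∀ y ∈ (eClosure ε (⋃ i, B i) ∩ Set.Iic M) ∩ Set.Ici (M - ε),
      ∃ m ∈ (eClosure ε (⋃ i, A i) ∩ Set.Iic M) ∩ Set.Ici (M - ε), m ≤ y := by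
    rintro y ⟨⟨a, b⟩, c⟩
    obtain ⟨m, hm, h1, h2⟩ := q2 y a c b
    exact ⟨m, ⟨⟨hm, h2.trans b⟩, h1⟩, h2⟩
  refine ⟨?_, ?_⟩
  · ext y
    constructor
    · rintro ⟨⟨a, b⟩, c⟩
      exact ⟨⟨p1 y a c, b⟩, c⟩
    · rintro ⟨⟨a, b⟩, c⟩
      exact ⟨⟨q1 y a c, b⟩, c⟩
  · rcases Set.eq_empty_or_nonempty
      ((eClosure ε (⋃ i, A i) ∩ Set.Iic M) ∩ Set.Ici (M - ε)) with he | hne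
    · refine Or.inl ⟨he, ?_⟩
      rw [Set.eq_empty_iff_forall_notMem]
      intro y hy
      obtain ⟨m, hm, -⟩ := Q y hy
      rw [he] at hm
      exact hm
    · have hne2 : ((eClosure ε (⋃ i, B i) ∩ Set.Iic M) ∩ Set.Ici (M - ε)).Nonempty := by
        obtain ⟨y, hy⟩ := hne
        obtain ⟨m, hm, -⟩ := P y hy
        exact ⟨m, hm⟩
      refine Or.inr ⟨hne, hne2, le_antisymm ?_ ?_⟩
      · refine le_csInf hne2 fun y hy => ?_
        obtain ⟨m, hm, hle⟩ := Q y hy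
        exact (csInf_le ⟨M - ε, fun t ht => ht.2⟩ hm).trans hle
      · refine le_csInf hne fun y hy => ?_
        obtain ⟨m, hm, hle⟩ := P y hy
        exact (csInf_le ⟨M - ε, fun t ht => ht.2⟩ hm).trans hle
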